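/- If α is a quadratic irrational whose continued fraction expansion is [a_0; a_1, ..., a_r, overline{a_{r+1}, ..., a_{r+s}}], then L(α) = log( (μ + √(μ² + 4)) / 2 ), where μ is the unique positive real number satisfying T_s(μ) = T(a_{r+1}, ..., a_{r+s}). -/

import Mathlib

open Filter Real Matrix

noncomputable section

/-- `contQ w n` is the denominator `Q n` of the `n`-th convergent of the
continued fraction `[0; w 1, w 2, …]`. -/
def contQ (w : ℕ → ℕ) : ℕ → ℕ
  | 0 => 1
  | 1 => w 1
  | n + 2 => w (n + 2) * contQ w (n + 1) + contQ w n

/-- The real number `[0; w 1, w 2, …]` has Lévy constant `ℓ`, i.e. the sequence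
`(log Q n)/n` converges to `ℓ`. -/
def HasLevyConstant (w : ℕ → ℕ) (ℓ : ℝ) : Prop :=
  Tendsto (fun n : ℕ => Real.log (contQ w n) / n) atTop (nhds ℓ)

/-- `L` is a (finite) factor of the infinite word `w = w 1 w 2 ⋯`. -/
def IsFactorSeq (w : ℕ → ℕ) (L : List ℕ) : Prop :=
  ∃ i : ℕ, L = (List.range L.length).map fun j => w (i + j + 1)

/-- The complexity function `p(n, w)`: the number of distinct factors of length `n`. -/
def complexity (w : ℕ → ℕ) (n : ℕ) : ℕ :=
  Set.ncard {L : List ℕ | L.length = n ∧ IsFactorSeq w L}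

/-- The mechanical word `s_{θ,ρ}` over `{a,b}` (floor version), indexed from `1`. -/
def mechWord (a b : ℕ) (θ ρ : ℝ) (n : ℕ) : ℕ :=
  if ⌊(n : ℝ) * θ + ρ⌋ - ⌊((n : ℝ) - 1) * θ + ρ⌋ = 0 then a else b

/-- The mechanical word `s'_{θ,ρ}` over `{a,b}` (ceiling version), indexed from `1`. -/
def mechWord' (a b : ℕ) (θ ρ : ℝ) (n : ℕ) : ℕ :=
  if ⌈(n : ℝ) * θ + ρ⌉ - ⌈((n : ℝ) - 1) * θ + ρ⌉ = 0 then a else b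

/-- `w` is a Sturmian word over `{a, b}`: a mechanical word with irrational slope. -/
def IsSturmianWord (a b : ℕ) (w : ℕ → ℕ) : Prop :=
  ∃ θ ρ : ℝ, Irrational θ ∧ θ ∈ Set.Icc (0 : ℝ) 1 ∧ ρ ∈ Set.Ico (0 : ℝ) 1 ∧
    (w = mechWord a b θ ρ ∨ w = mechWord' a b θ ρ)

/-- The matrix `[[x, 1], [1, 0]]`. -/
def cfMat (x : ℝ) : Matrix (Fin 2) (Fin 2) ℝ := !![x, 1; 1, 0]

/-- `T(b₁, …, b_n)`: the trace of `[[b₁,1],[1,0]] ⋯ [[b_n,1],[1,0]]` for a word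
`b₁ ⋯ b_n` over the positive integers.  The trace of the empty word is `2`. -/
def traceWord (L : List ℕ) : ℝ := ((L.map fun c => cfMat (c : ℝ)).prod).trace

/-- The polynomial `𝐓_n(x) = Tr([[x,1],[1,0]]^n)`. -/
def Tpoly (n : ℕ) (x : ℝ) : ℝ := ((cfMat x) ^ n).trace

/-- The lower Christoffel word `w_{p/q}` over `{a, b}`: the prefix of length `q`
of the mechanical word `s_{p/q, 0}`. -/
def christoffel (a b p q : ℕ) : List ℕ :=
  (List.range q).map fun n => mechWord a b ((p : ℝ) / (q : ℝ)) 0 (n + 1)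

/-- `T(w_{p/q})`, the trace attached to the lower Christoffel word of slope `p/q`. -/
def Tw (a b p q : ℕ) : ℝ := traceWord (christoffel a b p q)

/-- The continuant `K(b₁, …, b_n)`: the denominator of `[0; b₁, …, b_n]`. -/
def contList : List ℕ → ℕ
  | [] => 1
  | [x] => x
  | x :: y :: t => x * contList (y :: t) + contList t

/-- The standard words attached to `d₁, d₂, …` : `sturmM a b d (k+1)` is the word
`M_k`, where `M_{-1} = b`, `M_0 = a` and `M_k = M_{k-1}^{d_k} M_{k-2}`. -/
def sturmM (a b : ℕ) (d : ℕ → ℕ) : ℕ → List ℕ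
  | 0 => [b]
  | 1 => [a]
  | k + 2 => (List.replicate (d (k + 1)) (sturmM a b d (k + 1))).flatten ++ sturmM a b d k

/-- Denominators `q_k` of the convergents of `θ = [0; 1 + d₁, d₂, d₃, …]`. -/
def cfQ (d : ℕ → ℕ) : ℕ → ℕ
  | 0 => 1
  | 1 => 1 + d 1
  | k + 2 => d (k + 2) * cfQ d (k + 1) + cfQ d k

/-- Numerators `p_k` of the convergents of `θ = [0; 1 + d₁, d₂, d₃, …]`. -/
def cfP (d : ℕ → ℕ) : ℕ → ℕ
  | 0 => 0
  | 1 => 1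
  | k + 2 => d (k + 2) * cfP d (k + 1) + cfP d k

/-- `w` is ultimately periodic (so that `[0; w 1, w 2, …]` is a quadratic irrational). -/
def UltimatelyPeriodic (w : ℕ → ℕ) : Prop :=
  ∃ r s : ℕ, 0 < s ∧ ∀ n, r < n → w (n + s) = w n

end

/-- The product of the matrices of `w (n+1), …, w (n+s)`. -/
def windowProd (w : ℕ → ℕ) (s n : ℕ) : Matrix (Fin 2) (Fin 2) ℝ :=
  ((List.range s).map fun i => cfMat (w (n + 1 + i) : ℝ)).prod

lemma windowProd_succ (w : ℕ → ℕ) (s n : ℕ) :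
    windowProd w (s + 1) n = windowProd w s n * cfMat (w (n + 1 + s) : ℝ) := by
  simp [windowProd, List.range_succ]

lemma windowProd_succ' (w : ℕ → ℕ) (s n : ℕ) :
    windowProd w (s + 1) n = cfMat (w (n + 1) : ℝ) * windowProd w s (n + 1) := by
  simp only [windowProd, List.range_succ_eq_map, List.map_cons, List.map_map, List.prod_cons,
    add_zero]
  congr 3
  funext i
  simp only [Function.comp_apply]
  congr 3
  omega

lemma windowProd_add (w : ℕ → ℕ) (n s : ℕ) :
    windowProd w (n + s) 0 = windowProd w n 0 * windowProd w s n := by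
  induction s with
  | zero => simp [windowProd]
  | succ s ih =>
    rw [← add_assoc, windowProd_succ, windowProd_succ, ih, mul_assoc,
      show 0 + 1 + (n + s) = n + 1 + s by omega]

lemma det_windowProd (w : ℕ → ℕ) (s n : ℕ) : (windowProd w s n).det = (-1) ^ s := by
  induction s with
  | zero => simp [windowProd]
  | succ s ih =>
    rw [windowProd_succ, det_mul, ih, pow_succ]
    simp [cfMat, det_fin_two]

lemma windowProd_apply_zero (w : ℕ → ℕ) (n : ℕ) :
    windowProd w n 0 0 0 = contQ w n ∧ windowProd w (n + 1) 0 0 1 = contQ w n := by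
  have hcol (n : ℕ) : windowProd w (n + 1) 0 0 1 = windowProd w n 0 0 0 := by
    rw [windowProd_succ]
    simp [cfMat, mul_apply, Fin.sum_univ_two]
  have h : windowProd w n 0 0 0 = contQ w n := by
    induction n using Nat.twoStepInduction with
    | zero => simp [windowProd, contQ]
    | one => simp [windowProd, contQ, cfMat, List.range_succ]
    | more n h₀ h₁ =>
      rw [windowProd_succ, mul_apply, Fin.sum_univ_two, hcol, h₀, h₁,
        show 0 + 1 + (n + 1) = n + 2 by omega]
      simp [cfMat, contQ, mul_comm]
  exact ⟨h, (hcol n).trans h⟩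

lemma windowProd_periodic {w : ℕ → ℕ} {r s : ℕ} (hper : ∀ n, r < n → w (n + s) = w n)
    {n : ℕ} (hn : r ≤ n) : windowProd w s (n + s) = windowProd w s n := by
  unfold windowProd
  congr 2
  funext i
  rw [show n + s + 1 + i = n + 1 + i + s by omega, hper _ (by omega)]

lemma trace_windowProd {w : ℕ → ℕ} {r s : ℕ} (hper : ∀ n, r < n → w (n + s) = w n)
    {n : ℕ} (hn : r ≤ n) : (windowProd w s n).trace = (windowProd w s r).trace := by
  induction n, hn using Nat.le_induction with
  | base => rfl
  | succ n hn ih =>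
    cases s with
    | zero => simp [windowProd]
    | succ s =>
      rw [← ih, windowProd_succ' w s n, windowProd_succ w s (n + 1), trace_mul_comm,
        show n + 1 + 1 + s = n + 1 + (s + 1) by omega, hper _ (by omega)]

lemma mul_self_fin_two (A : Matrix (Fin 2) (Fin 2) ℝ) :
    A * A = A.trace • A - A.det • (1 : Matrix (Fin 2) (Fin 2) ℝ) := by
  ext i j
  fin_cases i <;> fin_cases j <;>
    simp [mul_apply, Fin.sum_univ_two, trace_fin_two, det_fin_two] <;> ring

lemma contQ_linear_recurrence {w : ℕ → ℕ} {r s : ℕ} (hper : ∀ n, r < n → w (n + s) = w n)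
    {n : ℕ} (hn : r ≤ n) :
    (contQ w (n + s + s) : ℝ) =
      (windowProd w s r).trace * contQ w (n + s) - (-1) ^ s * contQ w n := by
  have h : windowProd w (n + s + s) 0 = (windowProd w s r).trace • windowProd w (n + s) 0
      - (-1 : ℝ) ^ s • windowProd w n 0 := by
    rw [windowProd_add, windowProd_periodic hper hn, windowProd_add, mul_assoc, mul_self_fin_two,
      det_windowProd, trace_windowProd hper hn]
    simp [mul_sub]
  simpa [(windowProd_apply_zero w _).1] using congrFun (congrFun h 0) 0

lemma Tpoly_eq_pow_add_pow {x y : ℝ} (hxy : x * y = -1) (n : ℕ) :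
    Tpoly n (x + y) = x ^ n + y ^ n := by
  induction n using Nat.twoStepInduction with
  | zero => norm_num [Tpoly, trace_fin_two]
  | one => simp [Tpoly, trace_fin_two, cfMat]
  | more n h₀ h₁ =>
    have hd : (cfMat (x + y)).det = x * y := by simp [cfMat, det_fin_two, hxy]
    have ht : (cfMat (x + y)).trace = x + y := by simp [cfMat, trace_fin_two]
    have h : Tpoly (n + 2) (x + y) =
        (x + y) * Tpoly (n + 1) (x + y) - x * y * Tpoly n (x + y) := by
      unfold Tpoly
      rw [pow_add, pow_two, mul_self_fin_two, hd, ht, pow_succ]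
      simp [mul_sub]
    rw [h, h₀, h₁]
    ring

lemma contQ_pos {w : ℕ → ℕ} (hpos : ∀ n, 1 ≤ n → 0 < w n) (n : ℕ) : 0 < contQ w n := by
  induction n using Nat.twoStepInduction with
  | zero => simp [contQ]
  | one => exact hpos 1 le_rfl
  | more n h₀ h₁ => exact Nat.add_pos_right _ h₀

lemma contQ_monotone {w : ℕ → ℕ} (hpos : ∀ n, 1 ≤ n → 0 < w n) : Monotone (contQ w) := by
  refine monotone_nat_of_le_succ fun n => ?_
  cases n with
  | zero => exact hpos 1 le_rfl
  | succ n =>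
    exact (Nat.le_mul_of_pos_left _ (hpos (n + 2) (by omega))).trans (Nat.le_add_right _ _)

lemma exists_abs_le_of_eventually_periodic {f : ℕ → ℝ} {r s : ℕ} (hs : 0 < s)
    (hf : ∀ n, r ≤ n → f (n + s) = f n) : ∃ C, ∀ n, |f n| ≤ C := by
  refine ⟨∑ i ∈ Finset.range (r + s), |f i|, fun n => ?_⟩
  induction n using Nat.strong_induction_on with
  | _ n ih =>
    rcases lt_or_ge n (r + s) with h | h
    · exact Finset.single_le_sum (f := fun i => |f i|) (fun i _ => abs_nonneg _)
        (Finset.mem_range.2 h)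
    · obtain ⟨m, rfl⟩ : ∃ m, n = m + s := ⟨n - s, by omega⟩
      rw [hf m (by omega)]
      exact ih m (by omega)

/-- Sequences satisfying `u (n + 2s) = (x ^ s + y ^ s) u (n + s) - (x y) ^ s u n` grow like
`x ^ n` when `x` is the dominant root. -/
lemma tendsto_log_div_of_recurrence {u : ℕ → ℝ} (hu : ∀ n, 0 < u n) (hmono : Monotone u)
    {x y : ℝ} (hx : 0 < x) (hy : |y| < 1) {r s : ℕ} (hs : 0 < s)
    (hrec : ∀ n, r ≤ n → u (n + s + s) = (x ^ s + y ^ s) * u (n + s) - (x * y) ^ s * u n) :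
    Tendsto (fun n : ℕ => log (u n) / n) atTop (nhds (log x)) := by
  have hd : |y ^ s| < 1 := by
    rw [abs_pow]
    exact pow_lt_one₀ (abs_nonneg y) hy hs.ne'
  obtain ⟨hd₁, hd₂⟩ := abs_lt.1 hd
  set d := |y ^ s|
  have hlow (n : ℕ) : (1 - d) * u (n + s) ≤ u (n + s) - y ^ s * u n := by
    have h₁ : y ^ s * u n ≤ d * u n := mul_le_mul_of_nonneg_right (le_abs_self _) (hu n).le
    have h₂ : d * u n ≤ d * u (n + s) :=
      mul_le_mul_of_nonneg_left (hmono (Nat.le_add_right n s)) (abs_nonneg _)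
    linarith
  have hupp (n : ℕ) : u (n + s) - y ^ s * u n ≤ 2 * u (n + s) := by
    have h₁ : -(1 * u n) ≤ y ^ s * u n := by nlinarith [hu n]
    have h₂ := hmono (Nat.le_add_right n s)
    linarith
  have hDpos (n : ℕ) : 0 < u (n + s) - y ^ s * u n :=
    (mul_pos (sub_pos.2 hd) (hu _)).trans_le (hlow n)
  obtain ⟨C, hC⟩ := exists_abs_le_of_eventually_periodic
    (f := fun n => log (u (n + s) - y ^ s * u n) - n * log x) (r := r) hs fun n hn => by
      have h : u (n + s + s) - y ^ s * u (n + s) = x ^ s * (u (n + s) - y ^ s * u n) := by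
        rw [hrec n hn, mul_pow]
        ring
      simp only [h, log_mul (pow_pos hx s).ne' (hDpos n).ne', log_pow]
      push_cast
      ring
  have hbound (n : ℕ) :
      |log (u (n + s)) - n * log x| ≤ C + log 2 + |log (1 - d)| := by
    have h₁ := log_le_log (mul_pos (sub_pos.2 hd) (hu _)) (hlow n)
    have h₂ := log_le_log (hDpos n) (hupp n)
    rw [log_mul (sub_pos.2 hd).ne' (hu _).ne'] at h₁
    rw [log_mul two_ne_zero (hu _).ne'] at h₂
    have h₃ := abs_le.1 (hC n)
    have h₄ := neg_abs_le (log (1 - d))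
    have h₅ := log_pos one_lt_two
    have h₆ := abs_nonneg (log (1 - d))
    rw [abs_le]
    constructor <;> linarith [h₃.1, h₃.2]
  rw [← tendsto_add_atTop_iff_nat s]
  set B := C + log 2 + |log (1 - d)| + s * |log x|
  have hB : Tendsto (fun n : ℕ => B / ((n + s : ℕ) : ℝ)) atTop (nhds 0) :=
    (tendsto_add_atTop_iff_nat s).2 (tendsto_const_div_atTop_nhds_zero_nat B)
  rw [tendsto_iff_norm_sub_tendsto_zero]
  refine squeeze_zero (fun n => norm_nonneg _) (fun n => ?_) hB
  have hn : (0 : ℝ) < ((n + s : ℕ) : ℝ) := by exact_mod_cast Nat.add_pos_right n hs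
  rw [norm_eq_abs, div_sub' hn.ne', abs_div, abs_of_pos hn]
  gcongr
  have h : log (u (n + s)) - ((n + s : ℕ) : ℝ) * log x =
      (log (u (n + s)) - n * log x) - s * log x := by
    push_cast
    ring
  rw [h]
  refine (abs_sub _ _).trans (add_le_add (hbound n) ?_)
  rw [abs_mul, Nat.abs_cast]

/-- Proposition `prop:phi`. If `α` is the quadratic irrational with
continued fraction expansion `[a₀; a₁, …, a_r, \overline{a_{r+1}, …, a_{r+s}}]`, then
`𝓛(α) = log((μ + √(μ²+4))/2)` where `μ > 0` satisfies `𝐓_s(μ) = T(a_{r+1}, …, a_{r+s})`. -/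
theorem stmt10 (a : ℕ → ℕ) (hpos : ∀ n, 1 ≤ n → 0 < a n)
    (r s : ℕ) (hs : 0 < s) (hper : ∀ n, r < n → a (n + s) = a n)
    (μ : ℝ) (hμ : 0 < μ)
    (hμT : Tpoly s μ =
      (((List.range s).map fun i => cfMat (a (r + 1 + i) : ℝ)).prod).trace) :
    HasLevyConstant a (Real.log ((μ + Real.sqrt (μ ^ 2 + 4)) / 2)) := by
  have hsq : Real.sqrt (μ ^ 2 + 4) ^ 2 = μ ^ 2 + 4 := Real.sq_sqrt (by positivity)
  have hlt : Real.sqrt (μ ^ 2 + 4) < μ + 2 := by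
    rw [Real.sqrt_lt' (by positivity)]
    nlinarith
  have hgt : μ < Real.sqrt (μ ^ 2 + 4) := Real.lt_sqrt_of_sq_lt (by linarith)
  set x := (μ + Real.sqrt (μ ^ 2 + 4)) / 2 with hx
  set y := (μ - Real.sqrt (μ ^ 2 + 4)) / 2 with hy
  have hxy : x * y = -1 := by
    rw [hx, hy]
    linear_combination (-1 / 4) * hsq
  have hadd : x + y = μ := by
    rw [hx, hy]
    ring
  have htr : (windowProd a s r).trace = x ^ s + y ^ s := by
    rw [← Tpoly_eq_pow_add_pow hxy, hadd, hμT, windowProd]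
  refine tendsto_log_div_of_recurrence (u := fun n => (contQ a n : ℝ)) (y := y) (r := r)
    (fun n => by exact_mod_cast contQ_pos hpos n)
    (fun m n h => Nat.cast_le.2 (contQ_monotone hpos h)) (by positivity) ?_ hs fun n hn => ?_
  · rw [abs_lt]
    constructor <;> linarith
  · rw [contQ_linear_recurrence hper hn, htr, hxy]
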